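/- arXiv:cs/0703039 — 5 statements merged into one kernel-verified Lean document; each statement's English description precedes it below -/
import Mathlib

section
/- Let T be a binary tree domain, let x ∈ T, and let x₁,…,xₙ ∈ T be pairwise ⊑-incomparable nodes, each having x as a strict prefix. Then the set ⟨x,x₁,…,xₙ⟩ = {y ∈ T : x ⊑ y and, for every i, xᵢ is not a prefix of y} is a zone of T with least element x and with frontier exactly {x, x₁, …, xₙ}; moreover it is the unique zone of T whose frontier is {x, x₁, …, xₙ}. -/
/-- Nodes of the infinite binary tree: finite words over {0,1}. -/
abbrev Node : Type := List Bool

/-- A binary tree domain: a nonempty, prefix-closed, purely binary set of nodes. -/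
def IsTreeDomain (T : Set Node) : Prop :=
  T.Nonempty ∧ (∀ u v : Node, u <+: v → v ∈ T → u ∈ T) ∧
  ∀ u : Node, (u ++ [false] ∈ T ↔ u ++ [true] ∈ T)

/-- `x` is the least element of `Z` for the prefix ordering. -/
def ZoneLeast (Z : Set Node) (x : Node) : Prop := x ∈ Z ∧ ∀ z ∈ Z, x <+: z

/-- A zone of `T`: a subset of `T` with a least element for the prefix order,
convex for the prefix order. -/
def IsZone (T Z : Set Node) : Prop :=
  Z ⊆ T ∧ (∃ x, ZoneLeast Z x) ∧
  ∀ a y z : Node, a ∈ Z → z ∈ Z → a <+: y → y <+: z → y ∈ Z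

/-- The frontier of a zone `Z` of `T`: its least element together with all nodes
of `T \ Z` whose parent belongs to `Z`. -/
def zoneFrontier (T Z : Set Node) : Set Node :=
  {x | ZoneLeast Z x} ∪ {y | y ∈ T ∧ y ∉ Z ∧ y ≠ [] ∧ y.dropLast ∈ Z}

/-- The weight `D(Z)` of a finite zone `Z` under a distribution `D`. -/
def ZoneSum (D : Node → ℕ) (Z : Finset Node) : ℕ := ∑ z ∈ Z, D z

/-- A distribution `D` is `K`-sparse if `D(Z) ≤ |Z| + K·|F|` for every finite zone
`Z` of `T` with frontier `F`. -/
def Sparse (T : Set Node) (K : ℕ) (D : Node → ℕ) : Prop :=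
  ∀ Z : Finset Node, IsZone T ↑Z →
    ZoneSum D Z ≤ Z.card + K * (zoneFrontier T ↑Z).ncard

/-- A distribution `D` is strongly `K`-sparse if `D(Z) ≤ K·|F|` for every finite zone
`Z` of `T` with frontier `F`. -/
def StronglySparse (T : Set Node) (K : ℕ) (D : Node → ℕ) : Prop :=
  ∀ Z : Finset Node, IsZone T ↑Z →
    ZoneSum D Z ≤ K * (zoneFrontier T ↑Z).ncard

/-- A flow `f` is compatible with a distribution `D` on `T` if
`D(x) + f(x) ≤ 1 + f(x0) + f(x1)` for every inner node `x` of `T` and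
`D(x) + f(x) ≤ 1` for every leaf `x` of `T`. -/
def FlowCompatible (T : Set Node) (D : Node → ℕ) (f : Node → ℤ) : Prop :=
  ∀ x ∈ T,
    (x ++ [false] ∈ T → (D x : ℤ) + f x ≤ 1 + f (x ++ [false]) + f (x ++ [true])) ∧
    (x ++ [false] ∉ T → (D x : ℤ) + f x ≤ 1)

/-- A flow `f` is bounded by `C` on `T` if `|f(x)| ≤ C` for all `x ∈ T`. -/
def FlowBounded (T : Set Node) (C : ℕ) (f : Node → ℤ) : Prop :=
  ∀ x ∈ T, |f x| ≤ (C : ℤ)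

theorem prefix_dropLast_of_ne {a b : Node} (h : a <+: b) (hne : a ≠ b) : a <+: b.dropLast := by
  rcases List.eq_nil_or_concat b with rfl | ⟨c, t, rfl⟩
  · exact h
  · rw [List.concat_eq_append, List.prefix_concat_iff] at h
    rw [List.concat_eq_append] at hne
    simpa using h.resolve_left hne

theorem prefix_antisymm {a b : Node} (h : a <+: b) (h' : b <+: a) : a = b :=
  h.eq_of_length_le h'.length_le

theorem ZoneLeast.eq {Z : Set Node} {a b : Node} (ha : ZoneLeast Z a) (hb : ZoneLeast Z b) :
    a = b :=
  prefix_antisymm (ha.2 b hb.1) (hb.2 a ha.1)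

theorem ZoneLeast.prefix_of_mem_zoneFrontier {T Z : Set Node} {a y : Node} (ha : ZoneLeast Z a)
    (hy : y ∈ zoneFrontier T Z) : a <+: y := by
  rcases hy with hy | ⟨-, -, -, hy⟩
  · exact ha.2 y hy.1
  · exact (ha.2 _ hy).trans (List.dropLast_prefix y)

theorem zoneLeast_below {T : Set Node} {x : Node} (hx : x ∈ T) {S : Finset Node}
    (hstrict : ∀ xi ∈ S, x <+: xi ∧ x ≠ xi) :
    ZoneLeast {y | y ∈ T ∧ x <+: y ∧ ∀ xi ∈ S, ¬ xi <+: y} x :=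
  ⟨⟨hx, List.prefix_rfl, fun xi hxi h =>
    (hstrict xi hxi).2 (prefix_antisymm (hstrict xi hxi).1 h)⟩, fun _ hz => hz.2.1⟩

theorem zoneFrontier_below {T : Set Node} (hT : IsTreeDomain T)
    {x : Node} (hx : x ∈ T) {S : Finset Node} (hS : ↑S ⊆ T)
    (hstrict : ∀ xi ∈ S, x <+: xi ∧ x ≠ xi)
    (hincomp : ∀ a ∈ S, ∀ b ∈ S, a ≠ b → ¬ a <+: b) :
    zoneFrontier T {y | y ∈ T ∧ x <+: y ∧ ∀ xi ∈ S, ¬ xi <+: y} = insert x ↑S := by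
  have hleast := zoneLeast_below hx hstrict
  ext y
  constructor
  · rintro (hy | ⟨hyT, hyZ, -, hd⟩)
    · exact Or.inl (ZoneLeast.eq hy hleast)
    · right
      have hxy : x <+: y := hd.2.1.trans (List.dropLast_prefix y)
      by_contra hyS
      refine hyZ ⟨hyT, hxy, fun xi hxi h => hd.2.2 xi hxi (prefix_dropLast_of_ne h ?_)⟩
      rintro rfl
      exact hyS hxi
  · rintro (rfl | hy)
    · exact Or.inl hleast
    · have hyS : y ∈ S := hy
      obtain ⟨hxy, hne⟩ := hstrict y hyS
      have hnil : y ≠ [] := by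
        rintro rfl
        exact hne (List.prefix_nil.mp hxy)
      refine Or.inr ⟨hS hy, fun h => h.2.2 y hyS List.prefix_rfl, hnil,
        hT.2.1 _ _ (List.dropLast_prefix y) (hS hy), prefix_dropLast_of_ne hxy hne, ?_⟩
      intro xj hxj h
      by_cases hji : xj = y
      · subst hji
        have hlen := h.length_le
        have hpos := List.length_pos_of_ne_nil hnil
        rw [List.length_dropLast] at hlen
        omega
      · exact hincomp xj hxj y hyS hji (h.trans (List.dropLast_prefix y))

theorem ZoneLeast.mem_of_forall_not_prefix {T Z : Set Node} {x y : Node} (hT : IsTreeDomain T)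
    (hx : ZoneLeast Z x) (hy : y ∈ T) (hxy : x <+: y)
    (h : ∀ w ∈ zoneFrontier T Z, w ≠ x → ¬ w <+: y) : y ∈ Z := by
  obtain ⟨l, rfl⟩ := hxy
  induction l using List.reverseRecOn with
  | nil => simpa using hx.1
  | append_singleton l b ih =>
    rw [← List.append_assoc] at hy h ⊢
    have hp : x ++ l <+: x ++ l ++ [b] := List.prefix_append _ _
    have hl : x ++ l ∈ Z := ih (hT.2.1 _ _ hp hy) fun w hw hne hwl => h w hw hne (hwl.trans hp)
    by_contra hb
    exact h _ (Or.inr ⟨hy, hb, by simp, by rwa [List.dropLast_concat]⟩)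
      (fun he => hb (by rw [he]; exact hx.1)) List.prefix_rfl

/-- for `x ∈ T` and pairwise incomparable nodes `x₁, …, xₙ ∈ T`
(given as a finite set `S`), each having `x` as a strict prefix, the set
`⟨x, x₁, …, xₙ⟩ = {y ∈ T : x ⊑ y ∧ ∀ i, ¬ xᵢ ⊑ y}` is a zone of `T` with least
element `x` and frontier exactly `{x, x₁, …, xₙ}`, and it is the unique zone of
`T` with this frontier. -/
theorem zone_of_frontier (T : Set Node) (hT : IsTreeDomain T)
    (x : Node) (hx : x ∈ T) (S : Finset Node) (hS : ↑S ⊆ T)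
    (hstrict : ∀ xi ∈ S, x <+: xi ∧ x ≠ xi)
    (hincomp : ∀ a ∈ S, ∀ b ∈ S, a ≠ b → ¬ a <+: b) :
    IsZone T {y | y ∈ T ∧ x <+: y ∧ ∀ xi ∈ S, ¬ xi <+: y} ∧
    ZoneLeast {y | y ∈ T ∧ x <+: y ∧ ∀ xi ∈ S, ¬ xi <+: y} x ∧
    zoneFrontier T {y | y ∈ T ∧ x <+: y ∧ ∀ xi ∈ S, ¬ xi <+: y} = insert x ↑S ∧
    ∀ Z' : Set Node, IsZone T Z' → zoneFrontier T Z' = insert x ↑S →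
      Z' = {y | y ∈ T ∧ x <+: y ∧ ∀ xi ∈ S, ¬ xi <+: y} := by
  have hleast := zoneLeast_below hx hstrict
  refine ⟨⟨fun y hy => hy.1, ⟨x, hleast⟩, fun a y z ha hz hay hyz =>
    ⟨hT.2.1 y z hyz hz.1, ha.2.1.trans hay, fun xi hxi h => hz.2.2 xi hxi (h.trans hyz)⟩⟩,
    hleast, zoneFrontier_below hT hx hS hstrict hincomp, ?_⟩
  rintro Z ⟨hZT, ⟨x', hx'⟩, hconv⟩ hF
  have hx'x : x' = x := by
    refine prefix_antisymm (hx'.prefix_of_mem_zoneFrontier (hF ▸ Set.mem_insert x _)) ?_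
    have hmem : x' ∈ insert x (S : Set Node) := hF ▸ Or.inl hx'
    rcases hmem with rfl | h
    · exact List.prefix_rfl
    · exact (hstrict x' h).1
  subst hx'x
  have hnotmem : ∀ xi ∈ S, xi ∉ Z := by
    intro xi hxi
    have hmem : xi ∈ zoneFrontier T Z := hF ▸ Or.inr hxi
    rcases hmem with h | h
    · exact absurd (ZoneLeast.eq hx' h) (hstrict xi hxi).2
    · exact h.2.1
  ext y
  constructor
  · exact fun hy => ⟨hZT hy, hx'.2 y hy, fun xi hxi h =>
      hnotmem xi hxi (hconv x' xi y hx'.1 hy (hstrict xi hxi).1 h)⟩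
  · rintro ⟨hyT, hxy, hyS⟩
    refine hx'.mem_of_forall_not_prefix hT hyT hxy fun w hw hne => hyS w ?_
    rw [hF] at hw
    exact hw.resolve_left hne
end

section
/- Let T be a finite binary tree domain, let K be a natural number, and let D be a K-sparse distribution on T. Then there exists a flow f on T that is compatible with D, bounded by 2K + 1, and such that for every node x ∈ T there exist a finite zone Z_x of T with least element x, with frontier F_x, satisfying: (1) D(Z_x) + f(x) = |Z_x| + K·(|F_x| − 1) (as an equality of integers), and (2) f(y) ≥ K for every y ∈ F_x with y ≠ x. -/
/-- The nodes of `T \ W` that are either `c` itself or have their parent in `W`. -/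
def outerBoundary (T : Set Node) (c : Node) (W : Set Node) : Set Node :=
  {y | y ∈ T ∧ y ∉ W ∧ (y = c ∨ y ≠ [] ∧ y.dropLast ∈ W)}

/-- `W` is empty or a zone of `T` with least element `c`, its outer boundary only carries flow
at least `K`, and `v` is the excess of the capacity of `W` over its weight. -/
structure IsTightAt (T : Set Node) (K : ℕ) (D : Node → ℕ) (f : Node → ℤ) (c : Node)
    (W : Finset Node) (v : ℤ) : Prop where
  subset : ∀ z ∈ W, z ∈ T
  le : ∀ z ∈ W, c <+: z
  convex : ∀ z ∈ W, ∀ y, c <+: y → y <+: z → y ∈ W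
  sum_eq : (ZoneSum D W : ℤ) + v = W.card + K * (outerBoundary T c W).ncard
  le_flow : ∀ y ∈ outerBoundary T c W, (K : ℤ) ≤ f y

/-- The flow computed bottom-up from the leaves, with `n` levels of recursion. -/
noncomputable def greedyFlow (T : Set Node) (K : ℕ) (D : Node → ℕ) : ℕ → Node → ℤ
  | 0, _ => 0
  | n + 1, x => open Classical in
    if x ++ [false] ∈ T then
      1 - D x + min (K : ℤ) (greedyFlow T K D n (x ++ [false]))
        + min (K : ℤ) (greedyFlow T K D n (x ++ [true]))
    else 1 - D x

theorem exists_greedy_flow {T : Set Node} (hfin : T.Finite) (K : ℕ) (D : Node → ℕ) :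
    ∃ f : Node → ℤ, ∀ x ∈ T,
      (x ++ [false] ∈ T →
        f x = 1 - D x + min (K : ℤ) (f (x ++ [false])) + min (K : ℤ) (f (x ++ [true]))) ∧
      (x ++ [false] ∉ T → f x = 1 - D x) := by
  obtain ⟨N, hN⟩ := (hfin.image List.length).bddAbove
  refine ⟨fun x => greedyFlow T K D (N + 1 - x.length) x, fun x hx => ?_⟩
  have hxN : x.length ≤ N := hN ⟨x, hx, rfl⟩
  have h : N + 1 - x.length = (N - x.length) + 1 := by omega
  have h' : N + 1 - (x.length + 1) = N - x.length := by omega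
  constructor <;> intro hc
  · simp [h, h', greedyFlow, hc]
  · simp [h, greedyFlow, hc]

theorem child_prefix_unique {x y : Node} {a b : Bool} (ha : x ++ [a] <+: y)
    (hb : x ++ [b] <+: y) : a = b := by
  obtain ⟨s, rfl⟩ := ha
  obtain ⟨t, ht⟩ := hb
  simp at ht
  exact ht.1.symm

theorem not_child_prefix_self {x : Node} {a : Bool} : ¬ x ++ [a] <+: x := fun h => by
  simpa using h.length_le

theorem prefix_cases {x y : Node} (h : x <+: y) :
    y = x ∨ x ++ [false] <+: y ∨ x ++ [true] <+: y := by
  obtain ⟨t, rfl⟩ := h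
  rcases t with _ | ⟨_ | _, t⟩ <;> simp [List.prefix_append_right_inj]

namespace IsTightAt

variable {T : Set Node} {K : ℕ} {D : Node → ℕ} {f : Node → ℤ} {c x : Node} {W : Finset Node}
  {v : ℤ}

theorem prefix_of_mem_outerBoundary (h : IsTightAt T K D f c W v) {y : Node}
    (hy : y ∈ outerBoundary T c W) : c <+: y := by
  rcases hy.2.2 with rfl | h'
  · exact List.prefix_rfl
  · exact (h.le _ h'.2).trans (List.dropLast_prefix y)

theorem empty (hc : c ∈ T) (hf : (K : ℤ) ≤ f c) : IsTightAt T K D f c ∅ K := by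
  have hB : outerBoundary T c ↑(∅ : Finset Node) = {c} := by
    ext y
    simp only [outerBoundary, Finset.coe_empty, Set.mem_ofPred_eq, Set.mem_empty_iff_false,
      Set.mem_singleton_iff]
    grind
  refine ⟨by simp, by simp, by simp, ?_, ?_⟩
  · rw [hB]; simp [ZoneSum]
  · rw [hB]; simpa using hf

theorem singleton (hT : IsTreeDomain T) (hx : x ∈ T) (hleaf : x ++ [false] ∉ T) :
    IsTightAt T K D f x {x} (1 - D x) := by
  have hB : outerBoundary T x ↑({x} : Finset Node) = ∅ := by
    rw [Set.eq_empty_iff_forall_notMem]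
    rintro y ⟨hyT, hyx, h⟩
    simp only [Finset.coe_singleton, Set.mem_singleton_iff] at hyx h
    obtain ⟨hne, rfl⟩ := h.resolve_left hyx
    have hy := List.dropLast_append_getLast hne
    have hleaf' := mt (hT.2.2 y.dropLast).2 hleaf
    cases hb : y.getLast hne <;> rw [hb] at hy <;> simp_all
  refine ⟨by simpa using hx, by simp, ?_, ?_, ?_⟩
  · intro z hz y h1 h2
    rw [Finset.mem_singleton] at hz ⊢
    subst hz
    exact h2.eq_of_length_le h1.length_le
  · rw [hB]; simp [ZoneSum]
  · rw [hB]; simp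

theorem node (hfin : T.Finite) (hx : x ∈ T) (h0T : x ++ [false] ∈ T) (h1T : x ++ [true] ∈ T)
    {W₀ W₁ : Finset Node} {v₀ v₁ : ℤ} (h₀ : IsTightAt T K D f (x ++ [false]) W₀ v₀)
    (h₁ : IsTightAt T K D f (x ++ [true]) W₁ v₁) :
    IsTightAt T K D f x (insert x (W₀ ∪ W₁)) (1 - D x + v₀ + v₁) := by
  have hx₀ : x ∉ W₀ := fun h => not_child_prefix_self (h₀.le _ h)
  have hx₁ : x ∉ W₁ := fun h => not_child_prefix_self (h₁.le _ h)
  have hW : Disjoint W₀ W₁ := Finset.disjoint_left.2 fun z hz hz' =>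
    Bool.false_ne_true (child_prefix_unique (h₀.le z hz) (h₁.le z hz'))
  have hBd : Disjoint (outerBoundary T (x ++ [false]) ↑W₀) (outerBoundary T (x ++ [true]) ↑W₁) :=
    Set.disjoint_left.2 fun z hz hz' => Bool.false_ne_true (child_prefix_unique
      (h₀.prefix_of_mem_outerBoundary hz) (h₁.prefix_of_mem_outerBoundary hz'))
  have hB : outerBoundary T x ↑(insert x (W₀ ∪ W₁)) =
      outerBoundary T (x ++ [false]) ↑W₀ ∪ outerBoundary T (x ++ [true]) ↑W₁ := by
    ext y
    constructor
    · rintro ⟨hyT, hyW, hy⟩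
      simp only [Finset.mem_coe, Finset.mem_insert, Finset.mem_union, not_or] at hyW hy
      obtain ⟨hne, hd⟩ := hy.resolve_left hyW.1
      rcases hd with hd | hd | hd
      · have hy' := List.dropLast_append_getLast hne
        rw [hd] at hy'
        cases hb : y.getLast hne <;> rw [hb] at hy'
        · exact Or.inl ⟨hyT, hyW.2.1, Or.inl hy'.symm⟩
        · exact Or.inr ⟨hyT, hyW.2.2, Or.inl hy'.symm⟩
      · exact Or.inl ⟨hyT, hyW.2.1, Or.inr ⟨hne, hd⟩⟩
      · exact Or.inr ⟨hyT, hyW.2.2, Or.inr ⟨hne, hd⟩⟩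
    · rintro (hy | hy)
      · have hp := h₀.prefix_of_mem_outerBoundary hy
        refine ⟨hy.1, ?_, ?_⟩
        · simp only [Finset.mem_coe, Finset.mem_insert, Finset.mem_union, not_or]
          refine ⟨?_, hy.2.1, fun h => Bool.false_ne_true (child_prefix_unique hp (h₁.le _ h))⟩
          rintro rfl
          exact not_child_prefix_self hp
        · rcases hy.2.2 with rfl | h
          · simp
          · exact Or.inr ⟨h.1, by simp [Finset.mem_coe.1 h.2]⟩
      · have hp := h₁.prefix_of_mem_outerBoundary hy
        refine ⟨hy.1, ?_, ?_⟩
        · simp only [Finset.mem_coe, Finset.mem_insert, Finset.mem_union, not_or]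
          refine ⟨?_, fun h => Bool.false_ne_true (child_prefix_unique (h₀.le _ h) hp), hy.2.1⟩
          rintro rfl
          exact not_child_prefix_self hp
        · rcases hy.2.2 with rfl | h
          · simp
          · exact Or.inr ⟨h.1, by simp [Finset.mem_coe.1 h.2]⟩
  have hBfin : ∀ c W, (outerBoundary T c W).Finite := fun c W => hfin.subset fun y hy => hy.1
  have hxW : x ∉ W₀ ∪ W₁ := by simp [hx₀, hx₁]
  refine ⟨?_, ?_, ?_, ?_, ?_⟩
  · intro z hz
    simp only [Finset.mem_insert, Finset.mem_union] at hz
    rcases hz with rfl | hz | hz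
    exacts [hx, h₀.subset z hz, h₁.subset z hz]
  · intro z hz
    simp only [Finset.mem_insert, Finset.mem_union] at hz
    rcases hz with rfl | hz | hz
    exacts [List.prefix_rfl, (List.prefix_append _ _).trans (h₀.le z hz),
      (List.prefix_append _ _).trans (h₁.le z hz)]
  · intro z hz y hxy hyz
    simp only [Finset.mem_insert, Finset.mem_union] at hz ⊢
    rcases hz with rfl | hz | hz
    · exact Or.inl (hyz.eq_of_length_le hxy.length_le)
    · rcases prefix_cases hxy with h | h | h
      · exact Or.inl h
      · exact Or.inr (Or.inl (h₀.convex z hz y h hyz))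
      · exact absurd (child_prefix_unique (h₀.le z hz) (h.trans hyz)) Bool.false_ne_true
    · rcases prefix_cases hxy with h | h | h
      · exact Or.inl h
      · exact absurd (child_prefix_unique (h.trans hyz) (h₁.le z hz)) Bool.false_ne_true
      · exact Or.inr (Or.inr (h₁.convex z hz y h hyz))
  · have e₀ := h₀.sum_eq
    have e₁ := h₁.sum_eq
    rw [hB, Set.ncard_union_eq hBd (hBfin _ _) (hBfin _ _), Finset.card_insert_of_notMem hxW,
      Finset.card_union_of_disjoint hW]
    simp only [ZoneSum] at e₀ e₁ ⊢
    rw [Finset.sum_insert hxW, Finset.sum_union hW]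
    push_cast at e₀ e₁ ⊢
    linarith
  · rw [hB]
    rintro y (hy | hy)
    exacts [h₀.le_flow y hy, h₁.le_flow y hy]

theorem isZone (h : IsTightAt T K D f x W v) (hx : x ∈ W) : IsZone T ↑W :=
  ⟨h.subset, ⟨x, hx, h.le⟩, fun a y z ha hz hay hyz =>
    h.convex z hz y ((h.le a ha).trans hay) hyz⟩

theorem zoneFrontier_eq (h : IsTightAt T K D f x W v) (hx : x ∈ W) :
    zoneFrontier T ↑W = insert x (outerBoundary T x W) := by
  ext y
  simp only [zoneFrontier, outerBoundary, Set.mem_union, Set.mem_ofPred_eq, Set.mem_insert_iff]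
  constructor
  · rintro (hy | hy)
    · exact Or.inl ((hy.2 x hx).eq_of_length_le (h.le y hy.1).length_le)
    · exact Or.inr ⟨hy.1, hy.2.1, Or.inr hy.2.2⟩
  · rintro (rfl | ⟨h1, h2, rfl | h3⟩)
    · exact Or.inl ⟨hx, h.le⟩
    · exact absurd hx h2
    · exact Or.inr ⟨h1, h2, h3⟩

theorem ncard_zoneFrontier (hfin : T.Finite) (h : IsTightAt T K D f x W v) (hx : x ∈ W) :
    (zoneFrontier T ↑W).ncard = (outerBoundary T x W).ncard + 1 := by
  rw [h.zoneFrontier_eq hx]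
  exact Set.ncard_insert_of_notMem (fun h' => h'.2.1 hx) (hfin.subset fun y hy => hy.1)

end IsTightAt

theorem exists_isTightAt {T : Set Node} (hT : IsTreeDomain T) (hfin : T.Finite) {K : ℕ}
    {D : Node → ℕ} {f : Node → ℤ}
    (hf : ∀ x ∈ T,
      (x ++ [false] ∈ T →
        f x = 1 - D x + min (K : ℤ) (f (x ++ [false])) + min (K : ℤ) (f (x ++ [true]))) ∧
      (x ++ [false] ∉ T → f x = 1 - D x)) {x : Node} (hx : x ∈ T) :
    ∃ W : Finset Node, x ∈ W ∧ IsTightAt T K D f x W (f x) := by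
  obtain ⟨N, hN⟩ := (hfin.image List.length).bddAbove
  obtain ⟨n, hn⟩ : ∃ n, N < x.length + n := ⟨N + 1, by omega⟩
  induction n generalizing x with
  | zero => exact absurd (hN ⟨x, hx, rfl⟩) (by omega)
  | succ n ih =>
    by_cases hc : x ++ [false] ∈ T
    · have child : ∀ b, x ++ [b] ∈ T → ∃ W : Finset Node,
          IsTightAt T K D f (x ++ [b]) W (min (K : ℤ) (f (x ++ [b]))) := by
        intro b hb
        rcases le_total (K : ℤ) (f (x ++ [b])) with h | h
        · exact ⟨∅, by rw [min_eq_left h]; exact .empty hb h⟩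
        · obtain ⟨W, -, hW⟩ := ih hb (by simp; omega)
          exact ⟨W, by rwa [min_eq_right h]⟩
      have hc' := (hT.2.2 x).1 hc
      obtain ⟨W₀, h₀⟩ := child false hc
      obtain ⟨W₁, h₁⟩ := child true hc'
      refine ⟨insert x (W₀ ∪ W₁), by simp, ?_⟩
      rw [(hf x hx).1 hc]
      exact .node hfin hx hc hc' h₀ h₁
    · refine ⟨{x}, by simp, ?_⟩
      rw [(hf x hx).2 hc]
      exact .singleton hT hx hc

/-- existence part of the paper's Lemma `flow-finite`: for every
finite binary tree domain `T` and every `K`-sparse distribution `D` on `T`,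
there is a flow `f` compatible with `D`, bounded by `2K + 1`, such that every
node `x ∈ T` admits a finite zone `Z_x` of `T` with least element `x` and
frontier `F_x` satisfying `D(Z_x) + f(x) = |Z_x| + K·(|F_x| − 1)` and
`f(y) ≥ K` for all `y ∈ F_x` with `y ≠ x`. -/
theorem flow_finite (T : Set Node) (hT : IsTreeDomain T) (hfin : T.Finite)
    (K : ℕ) (D : Node → ℕ) (hD : Sparse T K D) :
    ∃ f : Node → ℤ, FlowCompatible T D f ∧ FlowBounded T (2 * K + 1) f ∧
      ∀ x ∈ T, ∃ Z : Finset Node, IsZone T ↑Z ∧ ZoneLeast ↑Z x ∧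
        (ZoneSum D Z : ℤ) + f x
          = (Z.card : ℤ) + (K : ℤ) * (((zoneFrontier T ↑Z).ncard : ℤ) - 1) ∧
        ∀ y ∈ zoneFrontier T ↑Z, y ≠ x → (K : ℤ) ≤ f y := by
  obtain ⟨f, hf⟩ := exists_greedy_flow hfin K D
  refine ⟨f, fun x hx => ⟨fun hc => ?_, fun hc => ?_⟩, fun x hx => ?_, fun x hx => ?_⟩
  · have := (hf x hx).1 hc
    have := min_le_right (K : ℤ) (f (x ++ [false]))
    have := min_le_right (K : ℤ) (f (x ++ [true]))
    linarith
  · linarith [(hf x hx).2 hc]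
  · obtain ⟨W, hxW, hW⟩ := exists_isTightAt hT hfin hf hx
    have hs := hD W (hW.isZone hxW)
    have he := hW.sum_eq
    rw [hW.ncard_zoneFrontier hfin hxW] at hs
    zify at hs
    have hlow : -(K : ℤ) ≤ f x := by linarith
    have hup : f x ≤ 2 * K + 1 := by
      by_cases hc : x ++ [false] ∈ T
      · have := (hf x hx).1 hc
        have := min_le_left (K : ℤ) (f (x ++ [false]))
        have := min_le_left (K : ℤ) (f (x ++ [true]))
        linarith [(D x).cast_nonneg (α := ℤ)]
      · have := (hf x hx).2 hc
        omega
    rw [abs_le]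
    push_cast
    constructor <;> omega
  · obtain ⟨W, hxW, hW⟩ := exists_isTightAt hT hfin hf hx
    refine ⟨W, hW.isZone hxW, ⟨hxW, hW.le⟩, ?_, fun y hy hyx => ?_⟩
    · rw [hW.ncard_zoneFrontier hfin hxW, hW.sum_eq]
      push_cast
      ring
    · rw [hW.zoneFrontier_eq hxW] at hy
      exact hW.le_flow y (hy.resolve_left hyx)
end

section
/- Let K ≥ 1 be a natural number and let D be a K-sparse distribution on the full binary tree (the binary tree domain consisting of all finite words over {0,1}). Then there exists an injective map P from the set {(x,i) : x a node, i ∈ ℕ, i < D(x)} into the set of nodes such that, for every node y ≠ ε, the number of pairs (x,i) with i < D(x) for which y is a prefix of exactly one of the two nodes x and P(x,i) is at most 7K. -/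
/-- A `K`-sparse distribution puts at most `3 * K + 1` items on each node: singletons are zones
whose frontier has at most three elements. -/
theorem Sparse.apply_le {K : ℕ} {D : Node → ℕ} (hD : Sparse Set.univ K D) (x : Node) :
    D x ≤ 3 * K + 1 := by
  have hzone : IsZone Set.univ (({x} : Finset Node) : Set Node) := by
    refine ⟨Set.subset_univ _, ⟨x, by simp [ZoneLeast]⟩, ?_⟩
    intro a y z ha hz hay hyz
    simp only [Finset.coe_singleton, Set.mem_singleton_iff] at *
    subst ha hz
    exact (hay.eq_of_length_le hyz.length_le).symm
  have hsub : zoneFrontier Set.univ (({x} : Finset Node) : Set Node) ⊆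
      (({x, x ++ [false], x ++ [true]} : Finset Node) : Set Node) := by
    rintro y (hy | ⟨-, -, hne, hy⟩)
    · have : y = x := by simpa using hy.1
      simp [this]
    · have hx : y.dropLast = x := by simpa using hy
      have hdec := List.dropLast_append_getLast hne
      rw [hx] at hdec
      rw [← hdec]
      cases y.getLast hne <;> simp
  have hcard := Set.ncard_le_ncard hsub (Finset.finite_toSet _)
  rw [Set.ncard_coe_finset] at hcard
  have hmul := Nat.mul_le_mul_left K (hcard.trans Finset.card_le_three)
  have hx := hD {x} hzone
  simp only [ZoneSum, Finset.sum_singleton, Finset.card_singleton] at hx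
  omega

/-- The node reached from `x` by one step to the right followed by `i` steps to the left. -/
def hook (x : Node) (i : ℕ) : Node := x ++ true :: List.replicate i false

theorem hook_inj {x x' : Node} {i i' : ℕ} (h : hook x i = hook x' i') : x = x' ∧ i = i' := by
  have key : ∀ (i i' : ℕ) (l l' : List Bool),
      List.replicate i false ++ true :: l = List.replicate i' false ++ true :: l' →
        l = l' ∧ i = i' := by
    intro i
    induction i with
    | zero => intro i' l l' h; cases i' <;> simp_all [List.replicate_succ]
    | succ i ih =>
      intro i' l l' h
      cases i' with
      | zero => simp [List.replicate_succ] at h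
      | succ i' => simpa using ih i' l l' (by simpa [List.replicate_succ] using h)
  have h' := congrArg List.reverse h
  simp only [hook, List.reverse_append, List.reverse_cons, List.reverse_replicate,
    List.append_assoc, List.singleton_append] at h'
  simpa using key _ _ _ _ h'

/-- A prefix of `hook x i` that is not a prefix of `x` is completed by steps to the left only. -/
theorem exists_hook_eq_append_replicate {x y : Node} {i : ℕ} (hy : y <+: hook x i)
    (hyx : ¬ y <+: x) : ∃ r ≤ i, y ++ List.replicate r false = hook x i := by
  obtain ⟨t, ht⟩ := hy
  rcases List.append_eq_append_iff.1 ht with ⟨c, hc, -⟩ | ⟨c, hc, hct⟩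
  · exact absurd ⟨c, hc.symm⟩ hyx
  · cases c with
    | nil => exact absurd ⟨[], by simp [hc]⟩ hyx
    | cons b c =>
      obtain ⟨-, hrep⟩ := List.cons.inj hct
      obtain ⟨hlen, -, htr⟩ := List.append_eq_replicate_iff.1 hrep.symm
      exact ⟨t.length, by omega, by rw [← htr, ht]⟩

/-- combinatorial core of the car-parking lemma: for `K ≥ 1` and a
`K`-sparse distribution `D` on the full binary tree, there is an injective
placement `P` of the pairs `(x, i)` with `i < D(x)` into the nodes such that,
for every node `y ≠ ε`, at most `7K` pairs `(x, i)` with `i < D(x)` are such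
that `y` is a prefix of exactly one of `x` and `P(x, i)`. -/
theorem car_parking (K : ℕ) (hK : 1 ≤ K) (D : Node → ℕ)
    (hD : Sparse (Set.univ : Set Node) K D) :
    ∃ P : Node → ℕ → Node,
      (∀ x i x' i', i < D x → i' < D x' → P x i = P x' i' → x = x' ∧ i = i') ∧
      ∀ y : Node, y ≠ [] →
        {p : Node × ℕ | p.2 < D p.1 ∧ Xor' (y <+: p.1) (y <+: P p.1 p.2)}.Finite ∧
        {p : Node × ℕ | p.2 < D p.1 ∧ Xor' (y <+: p.1) (y <+: P p.1 p.2)}.ncard ≤ 7 * K := by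
  refine ⟨hook, fun x i x' i' _ _ h => hook_inj h, fun y _ => ?_⟩
  let S : Set (Node × ℕ) :=
    {p : Node × ℕ | p.2 < D p.1 ∧ Xor (y <+: p.1) (y <+: hook p.1 p.2)}
  let R : Finset Node :=
    (Finset.range (3 * K + 1)).image fun r => y ++ List.replicate r false
  have hmaps : Set.MapsTo (fun p : Node × ℕ => hook p.1 p.2) S (R : Set Node) := by
    rintro ⟨x, i⟩ ⟨hi, ⟨hx, hn⟩ | ⟨hp, hn⟩⟩
    · exact absurd (hx.trans (List.prefix_append _ _)) hn
    · obtain ⟨r, hr, heq⟩ := exists_hook_eq_append_replicate hp hn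
      have hDx := hD.apply_le x
      exact Finset.mem_image.2 ⟨r, Finset.mem_range.2 (by dsimp only at hi; omega), heq⟩
  have hinjOn : Set.InjOn (fun p : Node × ℕ => hook p.1 p.2) S := fun p _ q _ h =>
    Prod.ext (hook_inj h).1 (hook_inj h).2
  refine ⟨Set.Finite.of_injOn hmaps hinjOn R.finite_toSet, ?_⟩
  have hle := Set.ncard_le_ncard_of_injOn _ hmaps hinjOn R.finite_toSet
  have hR : R.card ≤ 3 * K + 1 := Finset.card_image_le.trans (by simp)
  rw [Set.ncard_coe_finset] at hle
  exact hle.trans (by omega)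
end

section
/- Let φ be a bijection of the set of finite subsets of ℕ onto itself such that (1) for all finite sets A, B ⊆ ℕ: A ⊆ B if and only if φ(A) ⊆ φ(B), and (2) for all finite sets A, B ⊆ ℕ: (there exists n with A = {n} and B = {n+1}) if and only if (there exists n with φ(A) = {n} and φ(B) = {n+1}). Then φ is the identity. -/
/-- the identity is the only automorphism of the weak powerset
structure of `(ℕ, succ)`: a bijection `φ` of the finite subsets of `ℕ`
preserving the subset relation (in both directions) and the successor relation
transferred to singletons (in both directions) is the identity. -/
theorem automorphism_powerset_nat_succ (φ : Finset ℕ → Finset ℕ)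
    (hbij : Function.Bijective φ)
    (hsub : ∀ A B : Finset ℕ, A ⊆ B ↔ φ A ⊆ φ B)
    (hsucc : ∀ A B : Finset ℕ,
      (∃ n : ℕ, A = {n} ∧ B = {n + 1}) ↔ (∃ n : ℕ, φ A = {n} ∧ φ B = {n + 1})) :
    φ = id := by
  have hstep : ∀ n, ∃ m, φ {n} = {m} ∧ φ {n + 1} = {m + 1} := fun n =>
    (hsucc {n} {n + 1}).1 ⟨n, rfl, rfl⟩
  choose f hf hf' using hstep
  have hf_succ (n : ℕ) : f (n + 1) = f n + 1 :=
    Finset.singleton_injective ((hf (n + 1)).symm.trans (hf' n))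
  have hf_add (n : ℕ) : f n = f 0 + n := by
    induction n with
    | zero => rfl
    | succ n ih => rw [hf_succ, ih, Nat.add_assoc]
  have hf_zero : f 0 = 0 := by
    obtain ⟨A, hA⟩ := hbij.surjective {0}
    obtain ⟨B, hB⟩ := hbij.surjective {0 + 1}
    obtain ⟨n, rfl, -⟩ := (hsucc A B).2 ⟨0, hA, hB⟩
    have hn : f n = 0 := Finset.singleton_injective ((hf n).symm.trans hA)
    have := hf_add n
    omega
  have hφ (n : ℕ) : φ {n} = {n} := by
    rw [hf, hf_add, hf_zero, Nat.zero_add]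
  funext A
  ext x
  rw [id, ← Finset.singleton_subset_iff, ← Finset.singleton_subset_iff, hsub {x} A, hφ]
end

section
/- Let a and b be the two letters of a two-letter alphabet, and for a finite list l = [n₁, …, n_k] of natural numbers let w(l) denote the word b a^{n₁} b a^{n₂} b ⋯ b a^{n_k} b (formally: the letter b followed by the concatenation, over the entries n of l, of n copies of a followed by one b). Then for every natural number m, the word b a^m b (the letter b, followed by m copies of a, followed by b) is a factor (contiguous infix) of w(l) if and only if m occurs in l. -/
theorem replicate_append_singleton_prefix_iff {α : Type*} {a b : α} (hab : a ≠ b)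
    (m n : ℕ) (v : List α) :
    (List.replicate m a ++ [b]) <+: (List.replicate n a ++ b :: v) ↔ m = n := by
  induction m generalizing n with
  | zero => cases n <;> simp [List.replicate_succ, List.cons_prefix_cons, hab.symm]
  | succ m ih =>
    cases n with
    | zero => simp [List.replicate_succ, List.cons_prefix_cons, hab]
    | succ n => simpa [List.replicate_succ, List.cons_prefix_cons] using ih n

theorem cons_infix_replicate_append_iff {α : Type*} {a b : α} (hab : a ≠ b)
    (n : ℕ) (u v : List α) :
    (b :: u) <:+: (List.replicate n a ++ v) ↔ (b :: u) <:+: v := by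
  induction n with
  | zero => simp
  | succ n ih =>
    simp [List.replicate_succ, List.infix_cons_iff, List.cons_prefix_cons, hab.symm, ih]


/-- over a two-letter alphabet `{a, b}`, the word `b a^m b` is a
factor (contiguous infix) of `w(l) = b a^{n₁} b a^{n₂} b ⋯ b a^{n_k} b`
(for `l = [n₁, …, n_k]`) if and only if `m` occurs in `l`. -/
theorem factor_ba_pow_b_iff_mem {α : Type*} (a b : α) (hab : a ≠ b)
    (htwo : ∀ c : α, c = a ∨ c = b) :
    ∀ (l : List ℕ) (m : ℕ),
      (b :: (List.replicate m a ++ [b])) <:+: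
        (b :: l.flatMap (fun n => List.replicate n a ++ [b])) ↔ m ∈ l := by
  intro l m
  induction l with
  | nil => simp [List.infix_cons_iff, List.cons_prefix_cons]
  | cons n l ih =>
    rw [List.flatMap_cons, List.append_assoc, List.singleton_append, List.infix_cons_iff,
      List.cons_prefix_cons, replicate_append_singleton_prefix_iff hab,
      cons_infix_replicate_append_iff hab, ih]
    simp
end
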